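/- Let Γ be a connected bipartite graph with bipartition {U,W} that admits no automorphism swapping U and W. Then Aut(Γ × K₂) ≅ TFA(Γ) ⋊ Z₂, and consequently |Aut(Γ × K₂)| = 2·|TFA(Γ)|. -/

import Mathlib

/-- The automorphism group of a graph given by an adjacency relation `A`. -/
def autSubgroup {X : Type*} (A : X → X → Prop) : Subgroup (Equiv.Perm X) where
  carrier := {σ | ∀ x y, A x y ↔ A (σ x) (σ y)}
  one_mem' := fun _ _ => Iff.rfl
  mul_mem' := by
    intro a b ha hb x y
    simpa [Equiv.Perm.mul_apply] using (hb x y).trans (ha (b x) (b y))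
  inv_mem' := by
    intro a ha x y
    have h := ha (a⁻¹ x) (a⁻¹ y)
    simpa using h.symm

/-- The group of two-fold automorphisms (TF-automorphisms) of a graph with
adjacency relation `A`: pairs `(α, β)` of permutations such that
`(s, t)` is an arc iff `(α s, β t)` is an arc. -/
def tfaSubgroup {X : Type*} (A : X → X → Prop) :
    Subgroup (Equiv.Perm X × Equiv.Perm X) where
  carrier := {p | ∀ x y, A x y ↔ A (p.1 x) (p.2 y)}
  one_mem' := fun _ _ => Iff.rfl
  mul_mem' := by
    intro a b ha hb x y
    simpa [Equiv.Perm.mul_apply] using (hb x y).trans (ha (b.1 x) (b.2 y))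
  inv_mem' := by
    intro a ha x y
    have h := ha (a.1⁻¹ x) (a.2⁻¹ y)
    simpa using h.symm

/-- Adjacency of the direct (tensor) product of two graphs. -/
def prodAdj {X Y : Type*} (A : X → X → Prop) (B : Y → Y → Prop) :
    X × Y → X × Y → Prop := fun p q => A p.1 q.1 ∧ B p.2 q.2

/-- Adjacency of the complete graph `K₂` on `Bool`. -/
def k2Adj : Bool → Bool → Prop := fun i j => i ≠ j

/-- Adjacency of the cycle `Cₙ` on `ZMod n`. -/
def cycAdj (n : ℕ) : ZMod n → ZMod n → Prop := fun i j => i = j + 1 ∨ j = i + 1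

/-- The homomorphism from the group of order two determined by an involution. -/
def involutionHom {G : Type*} [Group G] (g : G) (hg : g * g = 1) :
    Multiplicative (ZMod 2) →* G where
  toFun z := if z = 1 then 1 else g
  map_one' := if_pos rfl
  map_mul' := by
    have key : ∀ z : Multiplicative (ZMod 2), z = 1 ∨ z = Multiplicative.ofAdd 1 := by decide
    have h1 : (Multiplicative.ofAdd 1 : Multiplicative (ZMod 2)) ≠ 1 := by decide
    have h2 : (Multiplicative.ofAdd 1 * Multiplicative.ofAdd 1 : Multiplicative (ZMod 2)) = 1 := by
      decide
    intro x y
    rcases key x with rfl | rfl <;> rcases key y with rfl | rfl <;> simp [h1, h2, hg]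

theorem involutionHom_apply {G : Type*} [Group G] (g : G) (hg : g * g = 1)
    (z : Multiplicative (ZMod 2)) : involutionHom g hg z = if z = 1 then 1 else g := rfl

/-- Swapping the two coordinates of a TF-automorphism. -/
def tfaSwap {X : Type*} {A : X → X → Prop} (hA : ∀ ⦃x y⦄, A x y → A y x) : MulAut (tfaSubgroup A) where
  toFun p := ⟨p.1.swap, fun x y => ⟨fun h => hA ((p.2 y x).1 (hA h)),
    fun h => hA ((p.2 y x).2 (hA h))⟩⟩
  invFun p := ⟨p.1.swap, fun x y => ⟨fun h => hA ((p.2 y x).1 (hA h)),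
    fun h => hA ((p.2 y x).2 (hA h))⟩⟩
  left_inv _ := rfl
  right_inv _ := rfl
  map_mul' _ _ := rfl

/-- The permutation of `X × Bool` acting by `p.1` on level `false` and by `p.2` on level `true`. -/
def levelPerm {X : Type*} (p : Equiv.Perm X × Equiv.Perm X) : Equiv.Perm (X × Bool) where
  toFun q := (bif q.2 then p.2 q.1 else p.1 q.1, q.2)
  invFun q := (bif q.2 then p.2.symm q.1 else p.1.symm q.1, q.2)
  left_inv := by rintro ⟨x, _ | _⟩ <;> simp
  right_inv := by rintro ⟨x, _ | _⟩ <;> simp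

/-- TF-automorphisms as level-preserving automorphisms of the product with `K₂`. -/
def tfaToAut {X : Type*} {A : X → X → Prop} (hA : ∀ ⦃x y⦄, A x y → A y x) :
    tfaSubgroup A →* autSubgroup (prodAdj A k2Adj) where
  toFun p := ⟨levelPerm p.1, by
    have h := p.2
    have h' : ∀ x y, A x y ↔ A (p.1.2 x) (p.1.1 y) := (tfaSwap hA p).2
    rintro ⟨x, _ | _⟩ ⟨y, _ | _⟩
    · simp [prodAdj, k2Adj, levelPerm]
    · simpa [prodAdj, k2Adj, levelPerm] using h x y
    · simpa [prodAdj, k2Adj, levelPerm] using h' x y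
    · simp [prodAdj, k2Adj, levelPerm]⟩
  map_one' := by
    ext ⟨x, _ | _⟩ <;> rfl
  map_mul' p q := by
    ext ⟨x, _ | _⟩ <;> rfl

/-- The involution exchanging the two levels of the product with `K₂`. -/
def levelSwap {X : Type*} (A : X → X → Prop) : autSubgroup (prodAdj A k2Adj) :=
  ⟨(Equiv.refl X).prodCongr Equiv.boolNot, by
    rintro ⟨x, _ | _⟩ ⟨y, _ | _⟩ <;> simp [prodAdj, k2Adj]⟩

theorem levelSwap_mul_self {X : Type*} (A : X → X → Prop) :
    levelSwap A * levelSwap A = 1 := by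
  ext ⟨x, _ | _⟩ <;> rfl

theorem tfaSwap_mul_self {X : Type*} {A : X → X → Prop} (hA : ∀ ⦃x y⦄, A x y → A y x) :
    tfaSwap hA * tfaSwap hA = 1 := rfl

/-- The homomorphism from the semidirect product of the TF-automorphism group and the group of
order two to the automorphism group of the product with `K₂`. -/
def semidirectToAut {X : Type*} {A : X → X → Prop} (hA : ∀ ⦃x y⦄, A x y → A y x) :
    (tfaSubgroup A) ⋊[involutionHom (tfaSwap hA) (tfaSwap_mul_self hA)] Multiplicative (ZMod 2) →*
      autSubgroup (prodAdj A k2Adj) :=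
  SemidirectProduct.lift (tfaToAut hA) (involutionHom (levelSwap A) (levelSwap_mul_self A)) (by
    intro z
    by_cases hz : z = 1
    · subst hz
      ext p x <;> simp
    · ext p ⟨x, _ | _⟩ <;> simp only [involutionHom_apply, if_neg hz] <;> rfl)

theorem semidirectToAut_injective {X : Type*} [Nonempty X] {A : X → X → Prop}
    (hA : ∀ ⦃x y⦄, A x y → A y x) : Function.Injective (semidirectToAut hA) := by
  rw [injective_iff_map_eq_one]
  rintro ⟨p, z⟩ h
  have h0 : ∀ q, (tfaToAut hA p * involutionHom (levelSwap A) (levelSwap_mul_self A) z).1 q = q :=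
    fun q => DFunLike.congr_fun (congrArg Subtype.val h) q
  by_cases hz : z = 1
  · subst hz
    have hp : p = 1 := by
      ext x
      · exact congrArg Prod.fst (h0 (x, false))
      · exact congrArg Prod.fst (h0 (x, true))
    rw [hp]; rfl
  · obtain ⟨x⟩ := ‹Nonempty X›
    rw [involutionHom_apply, if_neg hz] at h0
    have := congrArg Prod.snd (h0 (x, false))
    exact absurd this Bool.true_eq_false_eq_False

theorem exists_tfaToAut_eq {X : Type*} [Finite X] {A : X → X → Prop} (hA : ∀ ⦃x y⦄, A x y → A y x)
    (f : autSubgroup (prodAdj A k2Adj)) (hf : ∀ q, (f.1 q).2 = q.2) :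
    ∃ p, tfaToAut hA p = f := by
  have hinj : ∀ b, Function.Injective fun x => (f.1 (x, b)).1 := fun b x y hxy =>
    congrArg Prod.fst (f.1.injective (Prod.ext hxy (by rw [hf, hf])))
  let g : Bool → Equiv.Perm X := fun b =>
    Equiv.ofBijective _ (Finite.injective_iff_bijective.1 (hinj b))
  refine ⟨⟨(g false, g true), fun x y => ?_⟩, ?_⟩
  · have := f.2 (x, false) (y, true)
    simpa [g, prodAdj, k2Adj, hf] using this
  · ext ⟨x, _ | _⟩
    · rfl
    · exact (hf (x, false)).symm
    · rfl
    · exact (hf (x, true)).symm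

theorem semidirectToAut_surjective {X : Type*} [Finite X] {A : X → X → Prop} (hA : ∀ ⦃x y⦄, A x y → A y x)
    (h : ∀ f ∈ autSubgroup (prodAdj A k2Adj), ∃ d, ∀ q, (f q).2 = xor q.2 d) :
    Function.Surjective (semidirectToAut hA) := by
  intro f
  obtain ⟨d, hd⟩ := h f.1 f.2
  cases d
  · obtain ⟨p, hp⟩ := exists_tfaToAut_eq hA f (by simpa using hd)
    exact ⟨SemidirectProduct.inl p, by simp [semidirectToAut, hp]⟩
  · obtain ⟨p, hp⟩ := exists_tfaToAut_eq hA (f * levelSwap A) (by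
      intro q
      have : ((f * levelSwap A).1 q).2 = (f.1 (q.1, !q.2)).2 := rfl
      rw [this, hd]
      simp)
    refine ⟨SemidirectProduct.inl p * SemidirectProduct.inr (Multiplicative.ofAdd 1), ?_⟩
    have h1 : (Multiplicative.ofAdd 1 : Multiplicative (ZMod 2)) ≠ 1 := by decide
    rw [map_mul, semidirectToAut, SemidirectProduct.lift_inl, SemidirectProduct.lift_inr, hp,
      involutionHom_apply, if_neg h1, mul_assoc, levelSwap_mul_self, mul_one]

/-- For a connected graph properly coloured by `c`, an automorphism of the product with `K₂`
changes colours and levels uniformly on each component `{(v, c v xor k)}`. -/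
theorem exists_xor_const {V : Type*} {A : V → V → Prop}
    (hconn : ∀ u v, Relation.ReflTransGen A u v) (c : V → Bool) (hc : ∀ u v, A u v → c v = !c u)
    (v₀ : V) (f : Equiv.Perm (V × Bool)) (hf : f ∈ autSubgroup (prodAdj A k2Adj)) (k : Bool) :
    ∃ e d, ∀ v, c (f (v, xor (c v) k)).1 = xor (c v) e ∧ (f (v, xor (c v) k)).2 = xor (c v) d := by
  refine ⟨xor (c v₀) (c (f (v₀, xor (c v₀) k)).1), xor (c v₀) (f (v₀, xor (c v₀) k)).2,
    fun v => ?_⟩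
  induction hconn v₀ v with
  | refl => simp
  | @tail u w _ huw ih =>
    have h := (hf (u, xor (c u) k) (w, xor (c w) k)).1 ⟨huw, by
      rw [hc u w huw]; simp [k2Adj]⟩
    have h1 := hc _ _ h.1
    have h2 : (f (w, xor (c w) k)).2 = !(f (u, xor (c u) k)).2 := by
      have := h.2
      simp only [k2Adj] at this
      revert this
      generalize (f (w, xor (c w) k)).2 = a
      generalize (f (u, xor (c u) k)).2 = b
      revert a b
      decide
    rw [h1, h2, ih.1, ih.2, hc u w huw]
    simp

/-- An automorphism of the product with `K₂` that reverses the colours on a component induces a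
colour-reversing automorphism of the graph. -/
theorem exists_color_reversing {V : Type*} [Finite V] {A : V → V → Prop} (c : V → Bool)
    (hc : ∀ u v, A u v → c v = !c u) (f : Equiv.Perm (V × Bool))
    (hf : f ∈ autSubgroup (prodAdj A k2Adj)) (k d : Bool)
    (h : ∀ v, c (f (v, xor (c v) k)).1 = !c v ∧ (f (v, xor (c v) k)).2 = xor (c v) d) :
    ∃ σ ∈ autSubgroup A, ∀ v, c (σ v) = !c v := by
  have hinj : Function.Injective fun v => (f (v, xor (c v) k)).1 := by
    intro u v huv
    have hcc : c u = c v := by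
      have := congrArg c huv
      simpa [(h u).1, (h v).1] using this
    exact congrArg Prod.fst (f.injective (Prod.ext huv (by rw [(h u).2, (h v).2, hcc])))
  refine ⟨Equiv.ofBijective _ (Finite.injective_iff_bijective.1 hinj), fun u v => ?_,
    fun v => (h v).1⟩
  have huv := hf (u, xor (c u) k) (v, xor (c v) k)
  refine ⟨fun a => (huv.1 ⟨a, ?_⟩).1, fun a => (huv.2 ⟨a, ?_⟩).1⟩
  · simp [k2Adj, hc u v a]
  · have := hc _ _ a
    simp only [Equiv.ofBijective_apply] at this
    rw [(h u).1, (h v).1] at this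
    simp only [k2Adj, (h u).2, (h v).2]
    revert this
    cases c u <;> cases c v <;> simp

/-- If no automorphism reverses the colours, every automorphism of the product with `K₂` either
preserves or exchanges the two levels. -/
theorem exists_level_shift {V : Type*} [Finite V] {A : V → V → Prop}
    (hconn : ∀ u v, Relation.ReflTransGen A u v) (c : V → Bool) (hc : ∀ u v, A u v → c v = !c u)
    (v₀ : V) (hno : ¬∃ σ ∈ autSubgroup A, ∀ v, c (σ v) = !c v)
    (f : Equiv.Perm (V × Bool)) (hf : f ∈ autSubgroup (prodAdj A k2Adj)) :
    ∃ d, ∀ q, (f q).2 = xor q.2 d := by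
  have key : ∀ k, ∃ d, ∀ v, c (f (v, xor (c v) k)).1 = c v ∧
      (f (v, xor (c v) k)).2 = xor (c v) d := by
    intro k
    obtain ⟨e, d, h⟩ := exists_xor_const hconn c hc v₀ f hf k
    cases e
    · exact ⟨d, by simpa using h⟩
    · exact absurd (exists_color_reversing c hc f hf k d (by simpa using h)) hno
  choose d hd using key
  have hq : ∀ q : V × Bool, c (f q).1 = c q.1 ∧ (f q).2 = xor (c q.1) (d (xor (c q.1) q.2)) := by
    intro q
    simpa using hd (xor (c q.1) q.2) q.1
  have hne : d false ≠ d true := by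
    intro heq
    obtain ⟨q, hq'⟩ := f.surjective (v₀, xor (c v₀) (!d true))
    have h1 := hq q
    rw [hq'] at h1
    have h3 : d (xor (c q.1) q.2) = d true := by
      cases xor (c q.1) q.2
      · exact heq
      · rfl
    rw [h3, ← h1.1] at h1
    simp at h1
  refine ⟨d false, fun q => ?_⟩
  rw [(hq q).2]
  cases c q.1 <;> cases q.2 <;> cases h0 : d false <;> cases h1 : d true <;> simp_all

/-- If `Γ` is a connected bipartite graph with bipartition `{U, W}`
admitting no automorphism swapping `U` and `W`, then
`Aut(Γ × K₂) ≅ TFA(Γ) ⋊ Z₂`, and consequently `|Aut(Γ × K₂)| = 2 |TFA(Γ)|`. -/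
theorem stmt_5 {V : Type*} [Fintype V] (Adj : V → V → Prop) (hsymm : Symmetric Adj)
    (hconn : ∀ u v : V, Relation.ReflTransGen Adj u v)
    (U W : Set V) (hdisj : Disjoint U W) (hcover : U ∪ W = Set.univ)
    (hU : U.Nonempty) (hW : W.Nonempty)
    (hbip : ∀ u v, Adj u v → (u ∈ U ∧ v ∈ W) ∨ (u ∈ W ∧ v ∈ U))
    (hnoswap : ¬∃ σ ∈ autSubgroup Adj, ⇑σ '' U = W ∧ ⇑σ '' W = U) :
    (∃ φ : Multiplicative (ZMod 2) →* MulAut ↥(tfaSubgroup Adj),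
        Nonempty (↥(autSubgroup (prodAdj Adj k2Adj)) ≃*
          (↥(tfaSubgroup Adj) ⋊[φ] Multiplicative (ZMod 2)))) ∧
    Nat.card ↥(autSubgroup (prodAdj Adj k2Adj)) = 2 * Nat.card ↥(tfaSubgroup Adj) := by
  classical
  obtain ⟨v₀, -⟩ := hU
  have : Nonempty V := ⟨v₀⟩
  have hWU : ∀ v, v ∈ W ↔ v ∉ U := fun v =>
    ⟨fun hw hu => Set.disjoint_left.1 hdisj hu hw,
      fun hu => (hcover.symm ▸ Set.mem_univ v : v ∈ U ∪ W).resolve_left hu⟩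
  have hc : ∀ u v, Adj u v → decide (v ∈ U) = !decide (u ∈ U) := by
    intro u v huv
    have := hbip u v huv
    simp only [hWU] at this
    by_cases hu : u ∈ U <;> simp_all
  have hno : ¬∃ σ ∈ autSubgroup Adj, ∀ v, decide (σ v ∈ U) = !decide (v ∈ U) := by
    rintro ⟨σ, hσ, h⟩
    have h' : ∀ v, σ v ∈ U ↔ v ∉ U := fun v => by
      have := h v
      by_cases hv : v ∈ U <;> simpa [hv] using this
    refine hnoswap ⟨σ, hσ, ?_, ?_⟩ <;> ext v <;> rw [Equiv.image_eq_preimage_symm] <;>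
      have := h' (σ.symm v) <;> simp only [Equiv.apply_symm_apply] at this <;>
      simp only [Set.mem_preimage, hWU] <;> tauto
  let e := MulEquiv.ofBijective (semidirectToAut hsymm) ⟨semidirectToAut_injective hsymm,
    semidirectToAut_surjective hsymm
      (exists_level_shift hconn (fun v => decide (v ∈ U)) hc v₀ hno)⟩
  refine ⟨⟨_, ⟨e.symm⟩⟩, ?_⟩
  rw [← Nat.card_congr e.toEquiv, SemidirectProduct.card, mul_comm]
  simp
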